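/- For every nonnegative integer j and x ∈ ℝⁿ, Δ^j e^{−|x|²} = (−1)^j j! 4^j e^{−|x|²} L_j^{(n/2−1)}(|x|²), where L_j^{(γ)} denotes the generalized Laguerre polynomial. -/

import Mathlib

open MeasureTheory

/-- The generalized Laguerre polynomial
`L_k^{(γ)}(x) = ∑_{i=0}^k (-1)^i binom(k+γ, k-i) x^i / i!`, where
`binom(k+γ, k-i) = (∏_{m=0}^{k-i-1} (γ+i+1+m)) / (k-i)!`. -/
noncomputable def genLaguerre (k : ℕ) (γ : ℂ) (x : ℂ) : ℂ :=
  ∑ i ∈ Finset.range (k + 1),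
    ((-1) ^ i / (Nat.factorial i : ℂ)) *
      ((∏ m ∈ Finset.range (k - i), (γ + i + 1 + m)) / (Nat.factorial (k - i) : ℂ)) * x ^ i

/-- The Laplacian on `ℝⁿ` of a complex-valued function, as the sum of the
pure second derivatives in the coordinate directions. -/
noncomputable def laplacian {n : ℕ} (f : EuclideanSpace ℝ (Fin n) → ℂ) :
    EuclideanSpace ℝ (Fin n) → ℂ := fun x =>
  ∑ i : Fin n,
    iteratedFDeriv ℝ 2 f x ![EuclideanSpace.single i (1 : ℝ), EuclideanSpace.single i (1 : ℝ)]

open Polynomial in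
/-- Coefficients of the generalized Laguerre polynomial. -/
noncomputable def lagC (γ : ℂ) (j i : ℕ) : ℂ :=
  ((-1) ^ i / (Nat.factorial i : ℂ)) *
      ((∏ m ∈ Finset.range (j - i), (γ + i + 1 + m)) / (Nat.factorial (j - i) : ℂ))

open Polynomial in
/-- The generalized Laguerre polynomial as a polynomial. -/
noncomputable def lagP (γ : ℂ) (j : ℕ) : ℂ[X] :=
  ∑ i ∈ Finset.range (j + 1), C (lagC γ j i) * X ^ i

lemma lagP_eval (γ : ℂ) (j : ℕ) (z : ℂ) : (lagP γ j).eval z = genLaguerre j γ z := by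
  simp [lagP, lagC, genLaguerre, Polynomial.eval_finsetSum]

lemma lagP_coeff (γ : ℂ) (j i : ℕ) :
    (lagP γ j).coeff i = if i ≤ j then lagC γ j i else 0 := by
  simp [lagP, Polynomial.finsetSum_coeff, Polynomial.coeff_X_pow, Nat.lt_succ_iff]

lemma lagC_down (γ : ℂ) (i d : ℕ) :
    ((i : ℂ) + 1) * (i + γ + 1) * lagC γ (i + 1 + d) (i + 1)
      = -((d : ℂ) + 1) * lagC γ (i + 1 + d) i := by
  have e1 : i + 1 + d - (i + 1) = d := by omega
  have e2 : i + 1 + d - i = d + 1 := by omega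
  have h1 : ((i.factorial : ℕ) : ℂ) ≠ 0 := by exact_mod_cast i.factorial_ne_zero
  have h2 : ((d.factorial : ℕ) : ℂ) ≠ 0 := by exact_mod_cast d.factorial_ne_zero
  have h3 : (i : ℂ) + 1 ≠ 0 := by exact_mod_cast i.succ_ne_zero
  have h4 : (d : ℂ) + 1 ≠ 0 := by exact_mod_cast d.succ_ne_zero
  have hp : ∏ m ∈ Finset.range d, (γ + i + 1 + ((m : ℂ) + 1))
      = ∏ m ∈ Finset.range d, (γ + ((i : ℂ) + 1) + 1 + m) :=
    Finset.prod_congr rfl fun m _ => by ring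
  simp only [lagC, e1, e2, Finset.prod_range_succ', Nat.factorial_succ, Nat.cast_mul,
    Nat.cast_add, Nat.cast_one, hp, pow_succ, Nat.cast_zero]
  field_simp
  ring

lemma lagC_up (γ : ℂ) (i d : ℕ) :
    ((d : ℂ) + 1) * lagC γ (i + d + 1) i = (γ + i + d + 1) * lagC γ (i + d) i := by
  have e1 : i + d + 1 - i = d + 1 := by omega
  have e2 : i + d - i = d := by omega
  have h1 : ((i.factorial : ℕ) : ℂ) ≠ 0 := by exact_mod_cast i.factorial_ne_zero
  have h2 : ((d.factorial : ℕ) : ℂ) ≠ 0 := by exact_mod_cast d.factorial_ne_zero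
  have h4 : (d : ℂ) + 1 ≠ 0 := by exact_mod_cast d.succ_ne_zero
  simp only [lagC, e1, e2, Finset.prod_range_succ, Nat.factorial_succ, Nat.cast_mul,
    Nat.cast_add, Nat.cast_one]
  field_simp
  ring

lemma lagC_top (γ : ℂ) (j : ℕ) : ((j : ℂ) + 1) * lagC γ (j + 1) (j + 1) = - lagC γ j j := by
  have h1 : ((j.factorial : ℕ) : ℂ) ≠ 0 := by exact_mod_cast j.factorial_ne_zero
  have h4 : (j : ℂ) + 1 ≠ 0 := by exact_mod_cast j.succ_ne_zero
  simp [lagC, Nat.factorial_succ, pow_succ]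
  field_simp

/-- Coefficient recurrence, in terms of the zero-extended coefficients. -/
lemma lag_down' (γ : ℂ) (j i : ℕ) (h : i ≤ j) :
    ((i : ℂ) + 1) * (i + γ + 1) * (lagP γ j).coeff (i + 1)
      = -((j : ℂ) - i) * (lagP γ j).coeff i := by
  rw [lagP_coeff, lagP_coeff, if_pos h]
  obtain rfl | h' := h.eq_or_lt
  · simp
  · obtain ⟨d, rfl⟩ := Nat.exists_eq_add_of_le (Nat.succ_le_of_lt h')
    rw [Nat.succ_eq_add_one, if_pos (by omega), lagC_down]
    push_cast
    ring

lemma lag_rec (γ : ℂ) (j i : ℕ) :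
    ((i : ℂ) + 1) * (i + γ + 1) * (lagP γ j).coeff (i + 1)
      - (2 * i + γ + 1) * (lagP γ j).coeff i
      + (if i = 0 then 0 else (lagP γ j).coeff (i - 1))
      = -((j : ℂ) + 1) * (lagP γ (j + 1)).coeff i := by
  by_cases h : i ≤ j
  · rw [lag_down' γ j i h]
    obtain ⟨d, rfl⟩ := Nat.exists_eq_add_of_le h
    have h4 : (d : ℂ) + 1 ≠ 0 := by exact_mod_cast d.succ_ne_zero
    have hu := lagC_up γ i d
    have hu' : (lagP γ (i + d + 1)).coeff i = lagC γ (i + d + 1) i := by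
      rw [lagP_coeff, if_pos (by omega)]
    have hc : (lagP γ (i + d)).coeff i = lagC γ (i + d) i := by
      rw [lagP_coeff, if_pos (by omega)]
    have hd : ((d : ℂ) + 1) * (if i = 0 then 0 else (lagP γ (i + d)).coeff (i - 1))
        = - i * (γ + i) * lagC γ (i + d) i := by
      rcases i with _ | k
      · simp
      · have := lag_down' γ (k + 1 + d) k (by omega)
        rw [hc] at this
        simp only [Nat.add_sub_cancel, Nat.succ_ne_zero, if_false]
        push_cast at this ⊢
        linear_combination this
    rw [hu', hc]
    apply mul_left_cancel₀ h4
    push_cast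
    linear_combination hd + ((i : ℂ) + d + 1) * hu
  · have hi : i ≠ 0 := by omega
    rw [if_neg hi, lagP_coeff, lagP_coeff, lagP_coeff, lagP_coeff, if_neg h,
      if_neg (by omega)]
    by_cases h' : i = j + 1
    · subst h'
      have := lagC_top γ j
      simp only [Nat.add_sub_cancel, le_refl, if_true]
      linear_combination this
    · rw [if_neg (by omega), if_neg (by omega)]
      simp

open Polynomial in
lemma lagP_step (γ : ℂ) (j : ℕ) :
    X * derivative (derivative (lagP γ j)) + (C (γ + 1) - 2 * X) * derivative (lagP γ j)
      + (X - C (γ + 1)) * lagP γ j = C (-((j : ℂ) + 1)) * lagP γ (j + 1) := by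
  have e : X * derivative (derivative (lagP γ j)) + (C (γ + 1) - 2 * X) * derivative (lagP γ j)
      + (X - C (γ + 1)) * lagP γ j =
      X * derivative (derivative (lagP γ j)) + C (γ + 1) * derivative (lagP γ j)
      - C 2 * (X * derivative (lagP γ j)) + X * lagP γ j - C (γ + 1) * lagP γ j := by
    rw [show (C (2 : ℂ)) = 2 from rfl]
    ring
  rw [e]
  ext i
  have := lag_rec γ j i
  rw [coeff_C_mul, ← this]
  rcases i with _ | k
  · simp only [coeff_add, coeff_sub, coeff_C_mul, coeff_X_mul_zero, coeff_derivative]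
    simp
    try ring
  · simp only [coeff_add, coeff_sub, coeff_C_mul, coeff_X_mul, coeff_derivative]
    simp
    try ring

section radial
variable {n : ℕ}

/-- The derivative of `‖y‖²`, as a complex-valued bilinear map. -/
noncomputable def DD (n : ℕ) : EuclideanSpace ℝ (Fin n) →L[ℝ] EuclideanSpace ℝ (Fin n) →L[ℝ] ℂ :=
  (ContinuousLinearMap.compL ℝ (EuclideanSpace ℝ (Fin n)) ℝ ℂ Complex.ofRealCLM).comp
    ((2 : ℝ) • innerSL ℝ)

lemma DD_apply (x y : EuclideanSpace ℝ (Fin n)) : DD n x y = 2 * ((inner ℝ x y : ℝ) : ℂ) := by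
  simp [DD]

lemma hasFDerivAt_g (x : EuclideanSpace ℝ (Fin n)) :
    HasFDerivAt (fun y : EuclideanSpace ℝ (Fin n) => (‖y‖ : ℂ) ^ 2) (DD n x) x := by
  have h := (Complex.ofRealCLM.hasFDerivAt (x := ‖x‖ ^ 2)).comp x
    (hasStrictFDerivAt_norm_sq x).hasFDerivAt
  have e : (fun y : EuclideanSpace ℝ (Fin n) => (‖y‖ : ℂ) ^ 2)
      = Complex.ofRealCLM ∘ fun y => ‖y‖ ^ 2 := by
    ext y; simp
  have E : DD n x = Complex.ofRealCLM ∘SL (2 • (innerSL ℝ) x) := by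
    ext v
    simp [DD_apply]
  rw [e, E]
  exact h

lemma radial {G G' G'' : ℂ → ℂ} (h1 : ∀ z, HasDerivAt G (G' z) z)
    (h2 : ∀ z, HasDerivAt G' (G'' z) z) (x : EuclideanSpace ℝ (Fin n)) :
    laplacian (fun y => G ((‖y‖ : ℂ) ^ 2)) x
      = 4 * (‖x‖ : ℂ) ^ 2 * G'' ((‖x‖ : ℂ) ^ 2) + 2 * n * G' ((‖x‖ : ℂ) ^ 2) := by
  have d1 : fderiv ℝ (fun y : EuclideanSpace ℝ (Fin n) => G ((‖y‖ : ℂ) ^ 2))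
      = fun y => G' ((‖y‖ : ℂ) ^ 2) • DD n y := by
    funext y
    exact ((h1 _).comp_hasFDerivAt_of_eq y (hasFDerivAt_g y) rfl).fderiv
  have d2 := ((h2 _).comp_hasFDerivAt_of_eq x (hasFDerivAt_g x) rfl).smul (DD n).hasFDerivAt
  have key : ∀ i : Fin n, iteratedFDeriv ℝ 2 (fun y : EuclideanSpace ℝ (Fin n) =>
      G ((‖y‖ : ℂ) ^ 2)) x ![EuclideanSpace.single i (1 : ℝ), EuclideanSpace.single i (1 : ℝ)]
      = 4 * G'' ((‖x‖ : ℂ) ^ 2) * ((x i ^ 2 : ℝ) : ℂ) + 2 * G' ((‖x‖ : ℂ) ^ 2) := by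
    intro i
    rw [iteratedFDeriv_two_apply, d1]
    erw [d2.fderiv]
    simp [DD_apply, EuclideanSpace.inner_single_right]
    ring
  rw [laplacian, Finset.sum_congr rfl fun i _ => key i, Finset.sum_add_distrib, ← Finset.mul_sum,
    ← Complex.ofReal_sum]
  have hs : ∑ i, x i ^ 2 = ‖x‖ ^ 2 := by
    rw [EuclideanSpace.norm_sq_eq]; simp
  rw [hs]
  simp
  ring

end radial

lemma lap_step {n : ℕ} (j : ℕ) (a : ℂ) :
    laplacian (fun y : EuclideanSpace ℝ (Fin n) => a * Complex.exp (-(‖y‖ : ℂ) ^ 2) *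
      (lagP ((n : ℂ) / 2 - 1) j).eval ((‖y‖ : ℂ) ^ 2))
    = fun y => (a * (-4 * ((j : ℂ) + 1))) * Complex.exp (-(‖y‖ : ℂ) ^ 2) *
      (lagP ((n : ℂ) / 2 - 1) (j + 1)).eval ((‖y‖ : ℂ) ^ 2) := by
  have h : ∀ (P : Polynomial ℂ) (z : ℂ), HasDerivAt (fun z => a * Complex.exp (-z) * P.eval z)
      (a * Complex.exp (-z) * (P.derivative - P).eval z) z := by
    intro P z
    have := (((hasDerivAt_id z).neg.cexp).const_mul a).mul (P.hasDerivAt z)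
    refine this.congr_deriv ?_
    simp only [Polynomial.eval_sub, id, Pi.neg_apply]
    ring
  funext x
  rw [radial (G := fun z => a * Complex.exp (-z) * (lagP ((n : ℂ) / 2 - 1) j).eval z)
    (h _) (h _)]
  have := congrArg (Polynomial.eval ((‖x‖ : ℂ) ^ 2)) (lagP_step ((n : ℂ) / 2 - 1) j)
  simp at this ⊢
  linear_combination 4 * a * Complex.exp (-(‖x‖ : ℂ) ^ 2) * this

/-- `Δ^j e^{-|x|²} = (-1)^j j! 4^j e^{-|x|²} L_j^{(n/2-1)}(|x|²)`. -/
theorem stmt4 {n : ℕ} (j : ℕ) (x : EuclideanSpace ℝ (Fin n)) :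
    (laplacian^[j] (fun y : EuclideanSpace ℝ (Fin n) => Complex.exp (-(‖y‖ : ℂ) ^ 2))) x
      = (-1) ^ j * (Nat.factorial j : ℂ) * 4 ^ j * Complex.exp (-(‖x‖ : ℂ) ^ 2) *
          genLaguerre j ((n : ℂ) / 2 - 1) ((‖x‖ : ℂ) ^ 2) := by
  have main : laplacian^[j] (fun y : EuclideanSpace ℝ (Fin n) => Complex.exp (-(‖y‖ : ℂ) ^ 2))
      = fun y => ((-1) ^ j * (Nat.factorial j : ℂ) * 4 ^ j) * Complex.exp (-(‖y‖ : ℂ) ^ 2) *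
        (lagP ((n : ℂ) / 2 - 1) j).eval ((‖y‖ : ℂ) ^ 2) := by
    induction j with
    | zero =>
      funext y
      simp [lagP, lagC]
    | succ k ih =>
      rw [Function.iterate_succ_apply', ih, lap_step]
      funext y
      rw [Nat.factorial_succ]
      push_cast
      ring
  rw [main]
  simp only [lagP_eval]
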